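/- There is a universal constant C > 0 with the following property. Let p be a positive even integer, let k be a positive integer with p ≤ k, let 0 < ε < 1, and let X be a k-dimensional linear subspace of ℓ_p^m. Then there exist a set σ ⊆ {1, 2, …, m} of cardinality at most C ε⁻² (10k/p)^{p/2} and positive real weights {s_i}_{i∈σ} such that ∥x∥_p ≤ (Σ_{i∈σ} s_i x(i)^p)^{1/p} ≤ (1+ε) ∥x∥_p for all x = (x(1), …, x(m)) ∈ X. -/

import Mathlib

open Matrix

lemma bss_spec {n : ℕ} (P : Matrix (Fin n) (Fin n) ℝ) (hP : P.PosDef) :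
    ∃ (U : Matrix (Fin n) (Fin n) ℝ) (μ : Fin n → ℝ), U * Uᵀ = 1 ∧ Uᵀ * U = 1 ∧
      (∀ j, 0 < μ j) ∧ P = U * diagonal μ * Uᵀ := by
  refine ⟨hP.isHermitian.eigenvectorUnitary, hP.isHermitian.eigenvalues, ?_, ?_,
    hP.eigenvalues_pos, ?_⟩
  · have := (Matrix.mem_unitaryGroup_iff (A := (hP.isHermitian.eigenvectorUnitary : Matrix (Fin n) (Fin n) ℝ))).1 hP.isHermitian.eigenvectorUnitary.2
    simpa [star_eq_conjTranspose] using this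
  · have := (Matrix.mem_unitaryGroup_iff' (A := (hP.isHermitian.eigenvectorUnitary : Matrix (Fin n) (Fin n) ℝ))).1 hP.isHermitian.eigenvectorUnitary.2
    simpa [star_eq_conjTranspose] using this
  · have := hP.isHermitian.spectral_theorem
    simpa [star_eq_conjTranspose, Unitary.conjStarAlgAut_apply, Function.comp_def] using this

lemma bss_mul {n : ℕ} {U : Matrix (Fin n) (Fin n) ℝ} (h : Uᵀ * U = 1) (a b : Fin n → ℝ) :
    (U * diagonal a * Uᵀ) * (U * diagonal b * Uᵀ) = U * diagonal (fun j => a j * b j) * Uᵀ := by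
  calc _ = U * diagonal a * (Uᵀ * U) * diagonal b * Uᵀ := by simp only [Matrix.mul_assoc]
    _ = _ := by rw [h, Matrix.mul_one, Matrix.mul_assoc U, diagonal_mul_diagonal]

lemma bss_inv {n : ℕ} {U : Matrix (Fin n) (Fin n) ℝ} (h' : U * Uᵀ = 1) (h : Uᵀ * U = 1)
    (a : Fin n → ℝ) (ha : ∀ j, a j ≠ 0) :
    (U * diagonal a * Uᵀ)⁻¹ = U * diagonal (fun j => (a j)⁻¹) * Uᵀ := by
  apply Matrix.inv_eq_right_inv
  rw [bss_mul h]
  simp [ha, h']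

lemma bss_trace {n : ℕ} {U : Matrix (Fin n) (Fin n) ℝ} (h : Uᵀ * U = 1) (a : Fin n → ℝ) :
    (U * diagonal a * Uᵀ).trace = ∑ j, a j := by
  rw [Matrix.trace_mul_comm, ← Matrix.mul_assoc, h, Matrix.one_mul, trace_diagonal]

lemma bss_shift {n : ℕ} {U : Matrix (Fin n) (Fin n) ℝ} (h' : U * Uᵀ = 1) (a : Fin n → ℝ) (d : ℝ) :
    U * diagonal a * Uᵀ + d • (1 : Matrix (Fin n) (Fin n) ℝ) =
      U * diagonal (fun j => a j + d) * Uᵀ := by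
  have : diagonal (fun j => a j + d) = diagonal a + d • (1 : Matrix (Fin n) (Fin n) ℝ) := by
    rw [← diagonal_one, ← diagonal_smul, diagonal_add]; simp
  rw [this, Matrix.mul_add, Matrix.add_mul]
  simp [h']

lemma bss_posdef {n : ℕ} {U : Matrix (Fin n) (Fin n) ℝ} (h' : U * Uᵀ = 1)
    (a : Fin n → ℝ) (ha : ∀ j, 0 < a j) : (U * diagonal a * Uᵀ).PosDef := by
  have h1 : (diagonal a).PosDef := Matrix.PosDef.diagonal ha
  have := h1.mul_mul_conjTranspose_same (B := U) (by
    apply Function.LeftInverse.injective (g := fun w => w ᵥ* Uᵀ)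
    intro w
    simp [h'])
  simpa using this

lemma bss_posdef_iff {n : ℕ} (M : Matrix (Fin n) (Fin n) ℝ) :
    M.PosDef ↔ M.IsSymm ∧ ∀ x, x ≠ 0 → 0 < x ⬝ᵥ (M *ᵥ x) := by
  constructor
  · intro h
    refine ⟨by simpa [IsHermitian, IsSymm] using h.isHermitian, fun x hx => ?_⟩
    simpa using h.dotProduct_mulVec_pos hx
  · rintro ⟨h1, h2⟩
    refine Matrix.PosDef.of_dotProduct_mulVec_pos (by simpa [IsHermitian, IsSymm] using h1) fun x hx => ?_
    simpa using h2 x hx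

lemma bss_vv {n : ℕ} (v x : Fin n → ℝ) : x ⬝ᵥ (vecMulVec v v *ᵥ x) = (v ⬝ᵥ x)^2 := by
  rw [vecMulVec_mulVec]
  simp [dotProduct_smul, dotProduct_comm x v]
  ring

lemma bss_rank_pos {n : ℕ} (M : Matrix (Fin n) (Fin n) ℝ) (hM : M.PosDef) (v : Fin n → ℝ) (t : ℝ)
    (ht : 0 < 1 + t * (v ⬝ᵥ (M⁻¹ *ᵥ v))) : (M + t • vecMulVec v v).PosDef := by
  have hM0 := hM
  rw [bss_posdef_iff] at hM ⊢
  obtain ⟨hs, hp⟩ := hM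
  refine ⟨?_, fun x hx => ?_⟩
  · apply IsSymm.add hs
    apply IsSymm.smul
    simp [IsSymm, transpose_vecMulVec]
  · rw [add_mulVec, dotProduct_add, smul_mulVec, dotProduct_smul, bss_vv, smul_eq_mul]
    have hx0 := hp x hx
    rcases le_or_gt 0 t with h0 | h0
    · positivity
    by_cases hvx : v ⬝ᵥ x = 0
    · simp [hvx, hx0]
    have hinv : M * M⁻¹ = 1 := mul_nonsing_inv _ ((Matrix.isUnit_iff_isUnit_det _).1 hM0.isUnit)
    have key : 0 ≤ (x + (t * (v ⬝ᵥ x)) • (M⁻¹ *ᵥ v)) ⬝ᵥ (M *ᵥ (x + (t * (v ⬝ᵥ x)) • (M⁻¹ *ᵥ v))) := by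
      by_cases h : (x + (t * (v ⬝ᵥ x)) • (M⁻¹ *ᵥ v)) = 0
      · simp [h]
      · exact (hp _ h).le
    have e1 : (M⁻¹ *ᵥ v) ⬝ᵥ (M *ᵥ x) = v ⬝ᵥ x := by
      rw [dotProduct_mulVec, ← mulVec_transpose, hs.eq, mulVec_mulVec, hinv, one_mulVec]
    have e2 : M *ᵥ (M⁻¹ *ᵥ v) = v := by rw [mulVec_mulVec, hinv, one_mulVec]
    rw [mulVec_add, mulVec_smul, e2] at key
    simp only [add_dotProduct, dotProduct_add, smul_dotProduct, dotProduct_smul, e1, smul_eq_mul, dotProduct_comm x v, dotProduct_comm (M⁻¹ *ᵥ v) v] at key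
    have : 0 < (-t) * (v ⬝ᵥ x)^2 * (1 + t * (v ⬝ᵥ (M⁻¹ *ᵥ v))) := by
      have : 0 < -t := by linarith
      positivity
    nlinarith

lemma bss_rank_trace {n : ℕ} (M : Matrix (Fin n) (Fin n) ℝ) (hM : M.PosDef) (v : Fin n → ℝ) (t : ℝ)
    (ht : 0 < 1 + t * (v ⬝ᵥ (M⁻¹ *ᵥ v))) : (M + t • vecMulVec v v)⁻¹.trace =
      M⁻¹.trace - t * (v ⬝ᵥ ((M⁻¹ * M⁻¹) *ᵥ v)) / (1 + t * (v ⬝ᵥ (M⁻¹ *ᵥ v))) := by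
  have hinv : M * M⁻¹ = 1 := mul_nonsing_inv _ ((Matrix.isUnit_iff_isUnit_det _).1 hM.isUnit)
  have hsi : (M⁻¹).IsSymm := by simpa [IsHermitian, IsSymm] using hM.inv.isHermitian
  set a := v ⬝ᵥ (M⁻¹ *ᵥ v) with ha
  have : (M + t • vecMulVec v v)⁻¹ = M⁻¹ - (t / (1 + t * a)) • vecMulVec (M⁻¹ *ᵥ v) (M⁻¹ *ᵥ v) := by
    apply Matrix.inv_eq_right_inv
    have e2 : M *ᵥ (M⁻¹ *ᵥ v) = v := by rw [mulVec_mulVec, hinv, one_mulVec]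
    have e3 : v ᵥ* M⁻¹ = M⁻¹ *ᵥ v := by rw [← mulVec_transpose, hsi.eq]
    rw [Matrix.mul_sub, Matrix.add_mul, hinv, Matrix.mul_smul, Matrix.add_mul, Matrix.smul_mul, Matrix.smul_mul,
      vecMulVec_mul, e3, mul_vecMulVec, e2, vecMulVec_mul_vecMulVec, ← ha]
    ext i j
    simp [vecMulVec_apply]
    field_simp
    ring
  rw [this, trace_sub, trace_smul, trace_vecMulVec, dotProduct_mulVec, vecMul_mulVec, hsi.eq, ← dotProduct_mulVec, smul_eq_mul]
  ring

lemma bss_sum {n : ℕ} {ι : Type*} [Fintype ι] (v : ι → Fin n → ℝ)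
    (hv : ∑ i, vecMulVec (v i) (v i) = 1) (M : Matrix (Fin n) (Fin n) ℝ) :
    ∑ i, v i ⬝ᵥ (M *ᵥ v i) = M.trace := by
  have : M.trace = (M * ∑ i, vecMulVec (v i) (v i)).trace := by rw [hv, Matrix.mul_one]
  rw [this, Matrix.mul_sum, trace_sum]
  refine Finset.sum_congr rfl fun i _ => ?_
  rw [mul_vecMulVec, trace_vecMulVec, dotProduct_comm]

/-- upper average -/
lemma bss_upper {n : ℕ} (hn : 0 < n) (P : Matrix (Fin n) (Fin n) ℝ) (hP : P.PosDef) (d : ℝ) (hd : 0 < d) :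
    ∃ P' : Matrix (Fin n) (Fin n) ℝ, P' = P + d • (1 : Matrix (Fin n) (Fin n) ℝ) ∧ P'.PosDef ∧
      P'⁻¹.trace < P⁻¹.trace ∧
      (P'⁻¹ * P'⁻¹).trace / (P⁻¹.trace - P'⁻¹.trace) ≤ 1 / d := by
  obtain ⟨U, μ, h', h, hμ, rfl⟩ := bss_spec P hP
  have : Nonempty (Fin n) := ⟨⟨0, hn⟩⟩
  have hμd : ∀ j, 0 < μ j + d := fun j => by have := hμ j; positivity
  have lt : ∑ j, (μ j + d)⁻¹ < ∑ j, (μ j)⁻¹ := by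
    apply Finset.sum_lt_sum_of_nonempty Finset.univ_nonempty
    intro j _
    exact inv_strictAnti₀ (hμ j) (by linarith)
  refine ⟨_, rfl, ?_⟩
  rw [bss_shift h', bss_inv h' h _ (fun j => (hμ j).ne'), bss_inv h' h _ (fun j => (hμd j).ne'), bss_mul h,
    bss_trace h, bss_trace h, bss_trace h]
  refine ⟨bss_posdef h' _ hμd, lt, ?_⟩
  rw [div_le_div_iff₀ (by linarith) hd, one_mul, ← Finset.sum_sub_distrib, Finset.sum_mul]
  apply Finset.sum_le_sum
  intro j _
  have h1 := hμ j
  have h2 := hμd j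
  have : (μ j)⁻¹ - (μ j + d)⁻¹ = d * ((μ j)⁻¹ * (μ j + d)⁻¹) := by field_simp; ring
  rw [this]
  have : (μ j + d)⁻¹ ≤ (μ j)⁻¹ := inv_anti₀ h1 (by linarith)
  have : (μ j + d)⁻¹ * (μ j + d)⁻¹ ≤ (μ j)⁻¹ * (μ j + d)⁻¹ := by gcongr
  nlinarith

/-- lower average -/
lemma bss_lower {n : ℕ} (hn : 0 < n) (Q : Matrix (Fin n) (Fin n) ℝ) (hQ : Q.PosDef) (hQ1 : Q⁻¹.trace < 1) :
    ∃ Q' : Matrix (Fin n) (Fin n) ℝ, Q' = Q - 1 ∧ Q'.PosDef ∧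
      Q⁻¹.trace < Q'⁻¹.trace ∧
      1 - Q⁻¹.trace ≤ (Q'⁻¹ * Q'⁻¹).trace / (Q'⁻¹.trace - Q⁻¹.trace) - Q'⁻¹.trace := by
  obtain ⟨U, μ, h', h, hμ, rfl⟩ := bss_spec Q hQ
  have : Nonempty (Fin n) := ⟨⟨0, hn⟩⟩
  rw [bss_inv h' h _ (fun j => (hμ j).ne'), bss_trace h] at *
  have hμd : ∀ j, 0 < μ j + (-1) := fun j => by
    have : (μ j)⁻¹ ≤ ∑ j, (μ j)⁻¹ :=
      Finset.single_le_sum (f := fun j => (μ j)⁻¹) (fun i _ => (inv_pos.2 (hμ i)).le) (Finset.mem_univ j)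
    have h3 : (μ j)⁻¹ < 1 := by linarith
    have := (inv_lt_one₀ (hμ j)).1 h3
    linarith
  have lt : ∑ j, (μ j)⁻¹ < ∑ j, (μ j + (-1))⁻¹ := by
    apply Finset.sum_lt_sum_of_nonempty Finset.univ_nonempty
    intro j _
    exact inv_strictAnti₀ (hμd j) (by linarith)
  refine ⟨_, rfl, ?_⟩
  have e : U * diagonal μ * Uᵀ - 1 = U * diagonal (fun j => μ j + (-1)) * Uᵀ := by
    rw [← bss_shift h']; simp [sub_eq_add_neg]
  rw [e, bss_inv h' h _ (fun j => (hμd j).ne'), bss_mul h,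
    bss_trace h, bss_trace h]
  refine ⟨bss_posdef h' _ hμd, lt, ?_⟩
  rw [le_sub_iff_add_le, le_div_iff₀ (by linarith)]
  generalize hA : (fun j => (μ j)⁻¹) = a at *
  generalize hB : (fun j => (μ j + (-1))⁻¹) = b at *
  have ha : ∀ j, (μ j)⁻¹ = a j := fun j => congrFun hA j
  have hb : ∀ j, (μ j + (-1))⁻¹ = b j := fun j => congrFun hB j
  simp only [hb] at hQ1 lt ⊢
  have hap : ∀ j, 0 < a j := fun j => by rw [← ha]; exact inv_pos.2 (hμ j)
  have hbp : ∀ j, 0 < b j := fun j => by rw [← hb]; exact inv_pos.2 (hμd j)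
  have hab : ∀ j, b j - a j = a j * b j := fun j => by
    have h1 := hμ j
    have h2 := hμd j
    rw [← ha, ← hb]; field_simp; ring
  have hS : ∑ j, b j - ∑ j, a j = ∑ j, a j * b j := by
    rw [← Finset.sum_sub_distrib]; exact Finset.sum_congr rfl fun j _ => hab j
  have hB2 : ∑ j, b j * b j - ∑ j, a j * b j = ∑ j, a j * b j ^ 2 := by
    rw [← Finset.sum_sub_distrib]
    exact Finset.sum_congr rfl fun j _ => by
      rw [← sub_mul, hab]; ring
  have cs : (∑ j, a j * b j)^2 ≤ (∑ j, a j) * ∑ j, a j * b j ^ 2 := by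
    apply Finset.sum_sq_le_sum_mul_sum_of_sq_le_mul
    · intro j _; exact (hap j).le
    · intro j _; have := hap j; positivity
    · intro j _; apply le_of_eq; ring
  have hpos : 0 ≤ ∑ j, a j * b j ^ 2 := Finset.sum_nonneg fun j _ => by have := hap j; positivity
  have : 1 - ∑ j, a j + ∑ j, b j = 1 + ∑ j, a j * b j := by linarith
  rw [this, hS]
  nlinarith

lemma bss_step {n : ℕ} (hn : 0 < n) {ι : Type*} [Fintype ι] (v : ι → Fin n → ℝ)
    (hv : ∑ i, vecMulVec (v i) (v i) = 1) (P Q : Matrix (Fin n) (Fin n) ℝ) (hP : P.PosDef)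
    (hQ : Q.PosDef) (θ d : ℝ) (hd : 0 < d) (hθ : 1 / d + θ < 1 - θ)
    (hPt : P⁻¹.trace ≤ θ) (hQt : Q⁻¹.trace ≤ θ) :
    ∃ (i : ι) (t : ℝ), 0 < t ∧
      (P + d • (1 : Matrix (Fin n) (Fin n) ℝ) - t • vecMulVec (v i) (v i)).PosDef ∧
      (Q - 1 + t • vecMulVec (v i) (v i)).PosDef ∧
      (P + d • (1 : Matrix (Fin n) (Fin n) ℝ) - t • vecMulVec (v i) (v i))⁻¹.trace ≤ θ ∧
      (Q - 1 + t • vecMulVec (v i) (v i))⁻¹.trace ≤ θ := by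
  have hd1 : 0 < 1 / d := by positivity
  have hθ0 : 0 ≤ θ := le_trans hP.inv.posSemidef.trace_nonneg hPt
  obtain ⟨P', hP', hP'p, hPl, hPa⟩ := bss_upper hn P hP d hd
  obtain ⟨Q', hQ', hQ'p, hQl, hQa⟩ := bss_lower hn Q hQ (by linarith)
  rw [← hP', ← hQ']
  set DP := P⁻¹.trace - P'⁻¹.trace with hDP
  set DQ := Q'⁻¹.trace - Q⁻¹.trace with hDQ
  have hDPp : 0 < DP := by linarith
  have hDQp : 0 < DQ := by linarith
  have sU : ∑ i, (v i ⬝ᵥ ((P'⁻¹ * P'⁻¹) *ᵥ v i) / DP + v i ⬝ᵥ (P'⁻¹ *ᵥ v i)) <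
      ∑ i, (v i ⬝ᵥ ((Q'⁻¹ * Q'⁻¹) *ᵥ v i) / DQ - v i ⬝ᵥ (Q'⁻¹ *ᵥ v i)) := by
    rw [Finset.sum_add_distrib, Finset.sum_sub_distrib, ← Finset.sum_div, ← Finset.sum_div,
      bss_sum v hv, bss_sum v hv, bss_sum v hv, bss_sum v hv]
    linarith
  obtain ⟨i, -, hi⟩ := Finset.exists_lt_of_sum_lt sU
  have nn : ∀ M : Matrix (Fin n) (Fin n) ℝ, M.PosDef → 0 ≤ v i ⬝ᵥ (M *ᵥ v i) := fun M hM => by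
    simpa using hM.posSemidef.dotProduct_mulVec_nonneg (v i)
  have sq : ∀ M : Matrix (Fin n) (Fin n) ℝ, M.PosDef → 0 ≤ v i ⬝ᵥ ((M * M) *ᵥ v i) := fun M hM => by
    have hs : M.IsSymm := by simpa [IsHermitian, IsSymm] using hM.isHermitian
    rw [← mulVec_mulVec, dotProduct_mulVec, ← mulVec_transpose, hs.eq]
    exact Finset.sum_nonneg fun j _ => mul_self_nonneg _
  have p1 := nn _ hP'p.inv
  have q1 := nn _ hQ'p.inv
  have p2 := sq _ hP'p.inv
  have q2 := sq _ hQ'p.inv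
  have tP : ∀ t, 0 < 1 + t * (v i ⬝ᵥ (P'⁻¹ *ᵥ v i)) → _ := fun t => bss_rank_trace P' hP'p (v i) t
  have tQ : ∀ t, 0 < 1 + t * (v i ⬝ᵥ (Q'⁻¹ *ᵥ v i)) → _ := fun t => bss_rank_trace Q' hQ'p (v i) t
  have pP := fun t => bss_rank_pos P' hP'p (v i) t
  have pQ := fun t => bss_rank_pos Q' hQ'p (v i) t
  generalize v i ⬝ᵥ (P'⁻¹ *ᵥ v i) = a1 at *
  generalize v i ⬝ᵥ (Q'⁻¹ *ᵥ v i) = b1 at *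
  generalize v i ⬝ᵥ ((P'⁻¹ * P'⁻¹) *ᵥ v i) = a2 at *
  generalize v i ⬝ᵥ ((Q'⁻¹ * Q'⁻¹) *ᵥ v i) = b2 at *
  have h0 : 0 ≤ a2 / DP := by positivity
  set L := b2 / DQ - b1 with hL
  have hLp : 0 < L := by linarith
  have c1 : 0 < 1 + (-L⁻¹) * a1 := by
    have : L⁻¹ * a1 < 1 := by rw [inv_mul_lt_iff₀ hLp]; linarith
    linarith
  have c2 : 0 < 1 + L⁻¹ * b1 := by positivity
  refine ⟨i, L⁻¹, by positivity, ?_, pQ _ c2, ?_, ?_⟩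
  · rw [sub_eq_add_neg, ← neg_smul]; exact pP _ c1
  · rw [sub_eq_add_neg, ← neg_smul, tP _ c1]
    have : -(-L⁻¹ * a2 / (1 + -L⁻¹ * a1)) ≤ DP := by
      rw [← neg_div, div_le_iff₀ c1]
      have h3 : a2 / DP ≤ L - a1 := by linarith
      rw [div_le_iff₀ hDPp] at h3
      have h4 : L⁻¹ * a2 ≤ L⁻¹ * ((L - a1) * DP) := by gcongr
      have h5 : L⁻¹ * ((L - a1) * DP) = DP * (1 + -L⁻¹ * a1) := by field_simp; ring
      linarith
    linarith
  · rw [tQ _ c2]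
    have : DQ ≤ L⁻¹ * b2 / (1 + L⁻¹ * b1) := by
      rw [le_div_iff₀ c2]
      have h3 : b2 = DQ * (L + b1) := by rw [hL]; field_simp; ring
      rw [h3]
      apply le_of_eq
      field_simp
    linarith

lemma bss_iter {n : ℕ} (hn : 0 < n) {ι : Type*} [Fintype ι] [DecidableEq ι] (v : ι → Fin n → ℝ)
    (hv : ∑ i, vecMulVec (v i) (v i) = 1) (θ d : ℝ) (hθ0 : 0 < θ) (hd : 0 < d) (hθ : 1 / d + θ < 1 - θ) (T : ℕ) :
    ∃ (σ : Finset ι) (s : ι → ℝ), σ.card ≤ T ∧ (∀ i ∈ σ, 0 < s i) ∧ (∀ i ∉ σ, s i = 0) ∧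
      ((n / θ + d * T) • (1 : Matrix (Fin n) (Fin n) ℝ) - ∑ i, s i • vecMulVec (v i) (v i)).PosDef ∧
      (∑ i, s i • vecMulVec (v i) (v i) - (T - n / θ) • (1 : Matrix (Fin n) (Fin n) ℝ)).PosDef ∧
      ((n / θ + d * T) • (1 : Matrix (Fin n) (Fin n) ℝ) - ∑ i, s i • vecMulVec (v i) (v i))⁻¹.trace ≤ θ ∧
      (∑ i, s i • vecMulVec (v i) (v i) - (T - n / θ) • (1 : Matrix (Fin n) (Fin n) ℝ))⁻¹.trace ≤ θ := by
  induction T with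
  | zero =>
    have hnp : (0:ℝ) < n := by exact_mod_cast hn
    have hp : (0:ℝ) < n / θ := by positivity
    have h1 : ((n / θ : ℝ) • (1 : Matrix (Fin n) (Fin n) ℝ)).PosDef := Matrix.PosDef.one.smul hp
    have h2 : ((n / θ : ℝ) • (1 : Matrix (Fin n) (Fin n) ℝ))⁻¹.trace ≤ θ := by
      have : ((n / θ : ℝ) • (1 : Matrix (Fin n) (Fin n) ℝ))⁻¹ = (n / θ : ℝ)⁻¹ • 1 := by
        apply Matrix.inv_eq_right_inv
        rw [Matrix.smul_mul, Matrix.one_mul, smul_smul, mul_inv_cancel₀ hp.ne', one_smul]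
      rw [this, trace_smul]
      simp
      apply le_of_eq; field_simp
    refine ⟨∅, fun _ => 0, by simp, by simp, by simp, ?_⟩
    simp only [zero_smul, Finset.sum_const_zero, Nat.cast_zero, mul_zero, add_zero, sub_zero, zero_sub, neg_smul, neg_neg]
    exact ⟨h1, h1, h2, h2⟩
  | succ T ih =>
    obtain ⟨σ, s, hc, hs, hs0, hP, hQ, hPt, hQt⟩ := ih
    obtain ⟨i, t, ht, r1, r2, r3, r4⟩ := bss_step hn v hv _ _ hP hQ θ d hd hθ hPt hQt
    have hsum : ∑ j, (s + Pi.single i t : ι → ℝ) j • vecMulVec (v j) (v j) =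
        ∑ j, s j • vecMulVec (v j) (v j) + t • vecMulVec (v i) (v i) := by
      simp only [Pi.add_apply, add_smul, Finset.sum_add_distrib]
      congr 1
      rw [Finset.sum_eq_single i]
      · simp
      · intro j _ hj; simp [hj]
      · simp
    have hsn : ∀ j, 0 ≤ s j := fun j => by
      by_cases h : j ∈ σ
      · exact (hs j h).le
      · rw [hs0 j h]
    refine ⟨insert i σ, s + Pi.single i t, ?_, ?_, ?_, ?_⟩
    · exact (Finset.card_insert_le _ _).trans (by omega)
    · intro j hj
      rcases eq_or_ne j i with rfl | hji
      · have := hsn j; simp; positivity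
      · simpa [hji] using hs j (by simpa [hji] using hj)
    · intro j hj
      simp only [Finset.mem_insert, not_or] at hj
      simp [hj.1, hs0 j hj.2]
    · rw [hsum]
      have e1 : (n / θ + d * ((T + 1 : ℕ) : ℝ)) • (1 : Matrix (Fin n) (Fin n) ℝ) -
          (∑ j, s j • vecMulVec (v j) (v j) + t • vecMulVec (v i) (v i)) =
          (n / θ + d * T) • (1 : Matrix (Fin n) (Fin n) ℝ) - ∑ i, s i • vecMulVec (v i) (v i) + d • (1 : Matrix (Fin n) (Fin n) ℝ)
            - t • vecMulVec (v i) (v i) := by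
        push_cast; module
      have e2 : ∑ j, s j • vecMulVec (v j) (v j) + t • vecMulVec (v i) (v i) - (((T + 1 : ℕ) : ℝ) - n / θ) • (1 : Matrix (Fin n) (Fin n) ℝ) =
          ∑ i, s i • vecMulVec (v i) (v i) - (T - n / θ) • (1 : Matrix (Fin n) (Fin n) ℝ) - 1 + t • vecMulVec (v i) (v i) := by
        push_cast; module
      rw [e1, e2]
      exact ⟨r1, r2, r3, r4⟩

lemma bss_final {n : ℕ} (hn : 0 < n) {ι : Type*} [Fintype ι] [DecidableEq ι] (v : ι → Fin n → ℝ)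
    (hv : ∑ i, vecMulVec (v i) (v i) = 1) (ε : ℝ) (h0 : 0 < ε) (h1 : ε < 1) :
    ∃ (σ : Finset ι) (s : ι → ℝ), (σ.card : ℝ) ≤ 401 * ε⁻¹ ^ 2 * n ∧ (∀ i ∈ σ, 0 < s i) ∧
      ∀ c : Fin n → ℝ, ∑ i, (v i ⬝ᵥ c)^2 ≤ ∑ i ∈ σ, s i * (v i ⬝ᵥ c)^2 ∧
        ∑ i ∈ σ, s i * (v i ⬝ᵥ c)^2 ≤ (1 + ε) * ∑ i, (v i ⬝ᵥ c)^2 := by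
  obtain ⟨θ, hθ⟩ : ∃ θ, θ = ε / 20 := ⟨_, rfl⟩
  have hθ0 : 0 < θ := by rw [hθ]; positivity
  have hθ1 : θ < 1 / 20 := by rw [hθ]; linarith
  have h3 : 0 < 1 - 3 * θ := by linarith
  obtain ⟨d, hd⟩ : ∃ d, d = (1 - 3 * θ)⁻¹ := ⟨_, rfl⟩
  have hd0 : 0 < d := by rw [hd]; positivity
  have hd1 : d ≤ 1 + 4 * θ := by
    rw [hd, inv_le_iff_one_le_mul₀ h3]; nlinarith
  have hnp : (1:ℝ) ≤ n := by exact_mod_cast hn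
  obtain ⟨σ, s, hc, hs, hs0, hP, hQ, -, -⟩ := bss_iter hn v hv θ d hθ0 hd0
    (by rw [hd, one_div, inv_inv]; linarith) ⌈(n:ℝ) / θ^2⌉₊
  have hT1 := Nat.le_ceil ((n:ℝ) / θ^2)
  have hT2 := Nat.ceil_lt_add_one (a := (n:ℝ) / θ^2) (by positivity)
  generalize ⌈(n:ℝ) / θ^2⌉₊ = T at *
  have hnT : (n:ℝ) / θ ≤ θ * T := by
    calc (n:ℝ)/θ = θ * (n / θ^2) := by field_simp
      _ ≤ _ := by gcongr
  have hT0 : (0:ℝ) < T := lt_of_lt_of_le (by positivity) hT1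
  have hl : 0 < (T:ℝ) - n / θ := by nlinarith
  refine ⟨σ, fun i => ((T:ℝ) - n / θ)⁻¹ * s i, ?_, ?_, ?_⟩
  · have : (σ.card : ℝ) ≤ T := by exact_mod_cast hc
    have e : (n:ℝ) / θ^2 = 400 * ε⁻¹ ^ 2 * n := by rw [hθ]; field_simp; norm_num
    have : 1 ≤ ε⁻¹ ^ 2 := one_le_pow₀ ((one_le_inv₀ h0).2 h1.le)
    nlinarith
  · intro i hi
    have := hs i hi
    positivity
  · intro c
    have quad : ∀ r : ι → ℝ, c ⬝ᵥ ((∑ i, r i • vecMulVec (v i) (v i)) *ᵥ c) = ∑ i, r i * (v i ⬝ᵥ c)^2 := by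
      intro r
      rw [sum_mulVec, dotProduct_sum]
      refine Finset.sum_congr rfl fun i _ => ?_
      rw [smul_mulVec, dotProduct_smul, bss_vv, smul_eq_mul]
    have hcc : c ⬝ᵥ c = ∑ i, (v i ⬝ᵥ c)^2 := by
      have := quad 1
      simpa [hv] using this
    have p1 := hP.posSemidef.dotProduct_mulVec_nonneg c
    have q1 := hQ.posSemidef.dotProduct_mulVec_nonneg c
    simp only [star_trivial, sub_mulVec, dotProduct_sub, quad, smul_mulVec, dotProduct_smul, one_mulVec, hcc, smul_eq_mul] at p1 q1
    have hσ : ∑ i ∈ σ, ((T:ℝ) - n / θ)⁻¹ * s i * (v i ⬝ᵥ c)^2 = ((T:ℝ) - n / θ)⁻¹ * ∑ i, s i * (v i ⬝ᵥ c)^2 := by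
      rw [Finset.mul_sum, ← Finset.sum_subset (Finset.subset_univ σ)]
      · exact Finset.sum_congr rfl fun i _ => by ring
      · intro i _ hi; simp [hs0 i hi]
    rw [hσ]
    have hS : 0 ≤ ∑ i, (v i ⬝ᵥ c)^2 := Finset.sum_nonneg fun i _ => sq_nonneg _
    generalize ∑ i, (v i ⬝ᵥ c)^2 = S at *
    generalize ∑ i, s i * (v i ⬝ᵥ c)^2 = R at *
    constructor
    · rw [le_inv_mul_iff₀ hl]; linarith
    · rw [inv_mul_le_iff₀ hl]
      have : n / θ + d * T ≤ (T - n / θ) * (1 + ε) := by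
        have e : ε = 20 * θ := by rw [hθ]; ring
        rw [e]
        have a1 : n / θ + d * T ≤ (1 + 5 * θ) * T := by nlinarith
        have a2 : (1 - θ) * T ≤ T - n / θ := by linarith
        have a3 : (1 + 5 * θ) * T ≤ ((1 - θ) * T) * (1 + 20 * θ) := by nlinarith [mul_pos hθ0 hT0]
        have a4 : ((1 - θ) * T) * (1 + 20 * θ) ≤ (T - n / θ) * (1 + 20 * θ) := by gcongr
        linarith
      have := mul_le_mul_of_nonneg_right this hS
      linarith

set_option maxHeartbeats 1000000 in
lemma bss_subspace {m : ℕ} (W : Submodule ℝ (Fin m → ℝ)) (ε : ℝ) (h0 : 0 < ε) (h1 : ε < 1) :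
    ∃ (σ : Finset (Fin m)) (s : Fin m → ℝ),
      (σ.card : ℝ) ≤ 401 * ε⁻¹ ^ 2 * Module.finrank ℝ W ∧ (∀ i ∈ σ, 0 < s i) ∧
      ∀ w ∈ W, ∑ i, w i ^ 2 ≤ ∑ i ∈ σ, s i * w i ^ 2 ∧
        ∑ i ∈ σ, s i * w i ^ 2 ≤ (1 + ε) * ∑ i, w i ^ 2 := by
  let e := (WithLp.linearEquiv 2 ℝ (Fin m → ℝ)).symm
  let W' : Submodule ℝ (EuclideanSpace ℝ (Fin m)) := W.map e.toLinearMap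
  have hf : Module.finrank ℝ W' = Module.finrank ℝ W := LinearEquiv.finrank_map_eq e W
  rw [← hf]
  let b := stdOrthonormalBasis ℝ W'
  let v : Fin m → Fin (Module.finrank ℝ W') → ℝ := fun i j => (b j : EuclideanSpace ℝ (Fin m)) i
  have hv : ∑ i, vecMulVec (v i) (v i) = 1 := by
    ext j k
    have := orthonormal_iff_ite.1 b.orthonormal j k
    rw [Submodule.coe_inner, PiLp.inner_apply] at this
    simp only [Matrix.sum_apply, vecMulVec_apply, Matrix.one_apply, v]
    rw [← this]
    refine Finset.sum_congr rfl fun i _ => ?_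
    simp [mul_comm]
  have hw : ∀ w ∈ W, ∃ c, ∀ i, w i = v i ⬝ᵥ c := by
    intro w hw
    let w' : W' := ⟨e w, Submodule.mem_map_of_mem hw⟩
    refine ⟨fun j => b.repr w' j, fun i => ?_⟩
    have h2 := congrArg (fun z : W' => (z : EuclideanSpace ℝ (Fin m)) i) (b.sum_repr w')
    simp only [Submodule.coe_sum, Submodule.coe_smul] at h2
    have h3 : (w' : EuclideanSpace ℝ (Fin m)) i = w i := rfl
    rw [h3] at h2
    rw [← h2]
    rw [WithLp.ofLp_sum, Finset.sum_apply]
    refine Finset.sum_congr rfl fun j _ => ?_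
    rw [WithLp.ofLp_smul, Pi.smul_apply, smul_eq_mul, mul_comm]
  rcases Nat.eq_zero_or_pos (Module.finrank ℝ W') with hz | hz
  · refine ⟨∅, fun _ => 0, by simp [hz], by simp, ?_⟩
    intro w hwW
    obtain ⟨c, hc⟩ := hw w hwW
    have : ∀ i, w i = 0 := fun i => by
      rw [hc]
      apply Finset.sum_eq_zero
      intro j
      exact absurd j.2 (by omega)
    simp [this]
  · obtain ⟨σ, s, a1, a2, a3⟩ := bss_final hz v hv ε h0 h1
    refine ⟨σ, s, a1, a2, fun w hwW => ?_⟩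
    obtain ⟨c, hc⟩ := hw w hwW
    simp only [hc]
    exact a3 c

lemma pow_span {m : ℕ} (X : Submodule ℝ (Fin m → ℝ)) (q : ℕ) :
    ∃ W : Submodule ℝ (Fin m → ℝ), Module.finrank ℝ W ≤ (Module.finrank ℝ X).multichoose q ∧
      ∀ x ∈ X, x ^ q ∈ W := by
  let b := Module.finBasis ℝ X
  let f : Sym (Fin (Module.finrank ℝ X)) q → (Fin m → ℝ) :=
    fun k => ((k : Multiset (Fin (Module.finrank ℝ X))).map fun j => (b j : Fin m → ℝ)).prod
  refine ⟨Submodule.span ℝ (Set.range f), ?_, ?_⟩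
  · refine (finrank_range_le_card f).trans ?_
    rw [Sym.card_sym_eq_multichoose, Fintype.card_fin]
  · intro x hx
    have h2 := congrArg (fun z : X => (z : Fin m → ℝ)) (b.sum_repr ⟨x, hx⟩)
    simp only [Submodule.coe_sum, Submodule.coe_smul] at h2
    rw [← h2, Finset.sum_pow]
    apply Submodule.sum_mem
    intro k hk
    rw [Multiset.map_congr rfl (fun j _ => Algebra.smul_def _ _), Multiset.prod_map_mul]
    have : ∀ M : Multiset (Fin (Module.finrank ℝ X)),
        (M.map (fun j => algebraMap ℝ (Fin m → ℝ) (b.repr ⟨x, hx⟩ j))).prod =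
        algebraMap ℝ (Fin m → ℝ) (M.map (fun j => (b.repr ⟨x, hx⟩ j))).prod := by
      intro M
      rw [map_multiset_prod, Multiset.map_map]; rfl
    erw [this]
    rw [← Algebra.smul_def, ← nsmul_eq_mul]
    apply Submodule.smul_of_tower_mem
    apply Submodule.smul_mem
    exact Submodule.subset_span ⟨k, rfl⟩

lemma multichoose_bound (q k : ℕ) (hq : 0 < q) (hk : 2 * q ≤ k) :
    ((k.multichoose q : ℕ) : ℝ) ≤ (10 * k / (2 * q : ℝ)) ^ q := by
  have hq' : (0:ℝ) < q := by exact_mod_cast hq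
  have hk' : 2 * (q:ℝ) ≤ k := by exact_mod_cast hk
  rw [Nat.multichoose_eq]
  have h1 : (((k + q - 1).choose q : ℕ) : ℝ) ≤ ((k + q - 1 : ℕ) : ℝ) ^ q / (q.factorial : ℝ) := Nat.choose_le_pow_div q (k + q - 1)
  have h2 : ((k + q - 1 : ℕ) : ℝ) ≤ 3 / 2 * k := by
    have : ((k + q - 1 : ℕ) : ℝ) ≤ ((k + q : ℕ) : ℝ) := by exact_mod_cast Nat.sub_le _ _
    push_cast at this
    linarith
  have h3 : (q:ℝ) ^ q / (q.factorial : ℝ) ≤ 3 ^ q := by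
    refine (Real.pow_div_factorial_le_exp _ hq'.le q).trans ?_
    have : Real.exp (q:ℝ) = Real.exp 1 ^ q := by rw [← Real.exp_nat_mul]; simp
    rw [this]
    have := Real.exp_one_lt_d9
    gcongr
    linarith
  calc _ ≤ _ := h1
    _ ≤ (3 / 2 * k : ℝ) ^ q / (q.factorial : ℝ) := by gcongr
    _ = (3 / 2 * k / q : ℝ) ^ q * ((q:ℝ) ^ q / (q.factorial : ℝ)) := by
      rw [div_pow]; field_simp
    _ ≤ (3 / 2 * k / q : ℝ) ^ q * 3 ^ q := by gcongr
    _ = (9 * k / (2 * q : ℝ)) ^ q := by rw [← mul_pow]; congr 1; field_simp; norm_num [mul_comm]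
    _ ≤ _ := by gcongr; norm_num

/-- There is a universal constant `C > 0` with the following property.  Let `p` be a
positive even integer, let `k ≥ p`, let `0 < ε < 1`, and let `X` be a
`k`-dimensional subspace of `ℓ_p^m` (that is, `ℝ^m` with the norm
`‖x‖_p = (∑ i, |x i|^p)^(1/p)`).  Then there exist a set `σ ⊆ {1, …, m}` of
cardinality at most `C ε⁻² (10 k / p)^{p/2}` and positive weights `{s i}_{i ∈ σ}`
such that `‖x‖_p ≤ (∑ i ∈ σ, s i * x i ^ p) ^ (1/p) ≤ (1 + ε) ‖x‖_p`
for all `x ∈ X`. -/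
theorem subspace_lpm_sampling_tight :
    ∃ C : ℝ, 0 < C ∧
      ∀ (p k m : ℕ), Even p → 0 < p → p ≤ k →
        ∀ (ε : ℝ), 0 < ε → ε < 1 →
          ∀ X : Submodule ℝ (Fin m → ℝ),
            Module.finrank ℝ X = k →
            ∃ (σ : Finset (Fin m)) (s : Fin m → ℝ),
              (σ.card : ℝ) ≤ C * ε⁻¹ ^ 2 * (10 * k / p : ℝ) ^ (p / 2) ∧
              (∀ i ∈ σ, 0 < s i) ∧
              ∀ x ∈ X,
                (∑ i, |x i| ^ p) ^ ((1 : ℝ) / p) ≤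
                    (∑ i ∈ σ, s i * x i ^ p) ^ ((1 : ℝ) / p) ∧
                (∑ i ∈ σ, s i * x i ^ p) ^ ((1 : ℝ) / p) ≤
                    (1 + ε) * (∑ i, |x i| ^ p) ^ ((1 : ℝ) / p) := by
  refine ⟨401, by norm_num, ?_⟩
  intro p k m hpe hp hpk ε h0 h1 X hX
  obtain ⟨q, rfl⟩ := hpe.two_dvd
  have hq : 0 < q := by omega
  obtain ⟨W, hW, hXW⟩ := pow_span X q
  obtain ⟨σ, s, a1, a2, a3⟩ := bss_subspace W ε h0 h1
  refine ⟨σ, s, ?_, a2, ?_⟩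
  · refine a1.trans ?_
    have e : 2 * q / 2 = q := by omega
    rw [e]
    gcongr
    have hb := multichoose_bound q k hq hpk
    rw [hX] at hW
    have : (Module.finrank ℝ W : ℝ) ≤ (k.multichoose q : ℕ) := by exact_mod_cast hW
    push_cast
    exact this.trans hb
  · intro x hx
    obtain ⟨b1, b2⟩ := a3 _ (hXW x hx)
    have e1 : ∀ i, ((x ^ q) i) ^ 2 = x i ^ (2 * q) := fun i => by
      rw [Pi.pow_apply, ← pow_mul, mul_comm]
    have e2 : ∀ i, |x i| ^ (2 * q) = x i ^ (2 * q) := fun i => by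
      rw [pow_mul, sq_abs, pow_mul]
    simp only [e1] at b1 b2
    simp only [e2]
    have hS : 0 ≤ ∑ i, x i ^ (2 * q) := Finset.sum_nonneg fun i _ => by rw [pow_mul]; positivity
    have hr : (0:ℝ) ≤ 1 / ((2 * q : ℕ) : ℝ) := by positivity
    refine ⟨Real.rpow_le_rpow hS b1 hr, ?_⟩
    refine (Real.rpow_le_rpow (hS.trans b1) b2 hr).trans ?_
    rw [Real.mul_rpow (by linarith) hS]
    gcongr
    have hle : 1 / ((2 * q : ℕ) : ℝ) ≤ 1 := by
      rw [div_le_one (by positivity)]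
      exact_mod_cast hp
    calc (1 + ε) ^ (1 / ((2 * q : ℕ) : ℝ)) ≤ (1 + ε) ^ (1:ℝ) :=
        Real.rpow_le_rpow_of_exponent_le (by linarith) hle
      _ = 1 + ε := Real.rpow_one _
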